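/- Let n ≥ 1 and m ≥ 2 be integers, α, β > 0 real with α > 2β, and 1 ≤ p ≤ (2m+2)/(m+3). Set a = 2n(1/p − 1/2) − 1 and b = 2(n+m)(1/p − 1/2) − 1. For μ > 0 let λ_k(μ) be the unique positive real λ with (2k+n)^α λ^α + λ^{2β} = μ, and set λ_k'(μ) = 1/(α(2k+n)^α λ_k(μ)^{α−1} + 2β λ_k(μ)^{2β−1}). Then there exists a constant C > 0, depending only on n, m, p, α, β, such that for every μ > 1 the series ∑_{k=0}^∞ (2k+n)^a · λ_k(μ)^b · λ_k'(μ) converges and is at most C · μ^{(2/α)(n+m)(1/p−1/2) − 1}. -/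

import Mathlib

/-- A single summand of the spectral series, at a solution `l` of `N^α l^α + l^(2β) = μ`. -/
lemma spectral_term_le {α β N l μ c d : ℝ} (hα : 0 < α) (hβ : 0 < β) (hαβ : 2 * β ≤ α)
    (hN : 0 < N) (hl : 0 < l) (hμ : 0 < μ) (hd : 0 ≤ d)
    (h : N ^ α * l ^ α + l ^ (2 * β) = μ) :
    N ^ (c - 1) * l ^ (d - 1) * (1 / (α * N ^ α * l ^ (α - 1) + 2 * β * l ^ (2 * β - 1))) ≤
      1 / (2 * β) * μ ^ (d / α - 1) * N ^ (c - 1 - d) := by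
  have hNα : 0 < N ^ α := Real.rpow_pos_of_pos hN _
  have hlα : 0 < l ^ α := Real.rpow_pos_of_pos hl _
  have hlβ : 0 < l ^ (2 * β) := Real.rpow_pos_of_pos hl _
  have hden : 2 * β * μ / l ≤ α * N ^ α * l ^ (α - 1) + 2 * β * l ^ (2 * β - 1) := by
    rw [Real.rpow_sub_one hl.ne', Real.rpow_sub_one hl.ne', div_le_iff₀ hl]
    have : (α * N ^ α * (l ^ α / l) + 2 * β * (l ^ (2 * β) / l)) * l
        = α * (N ^ α * l ^ α) + 2 * β * l ^ (2 * β) := by field_simp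
    rw [this, ← h]
    nlinarith [mul_pos hNα hlα]
  have hinv : 1 / (α * N ^ α * l ^ (α - 1) + 2 * β * l ^ (2 * β - 1)) ≤ l / (2 * β * μ) := by
    refine (one_div_le_one_div_of_le (by positivity) hden).trans_eq ?_
    rw [one_div_div]
  have hle : l ≤ μ ^ (1 / α) / N := by
    rw [le_div_iff₀ hN, mul_comm]
    have : (N * l) ^ α ≤ μ := by
      rw [Real.mul_rpow hN.le hl.le]; linarith
    calc N * l = ((N * l) ^ α) ^ (1 / α) := by
          rw [← Real.rpow_mul (by positivity), mul_one_div_cancel hα.ne', Real.rpow_one]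
      _ ≤ μ ^ (1 / α) := Real.rpow_le_rpow (by positivity) this (by positivity)
  calc N ^ (c - 1) * l ^ (d - 1) * (1 / (α * N ^ α * l ^ (α - 1) + 2 * β * l ^ (2 * β - 1)))
      ≤ N ^ (c - 1) * l ^ (d - 1) * (l / (2 * β * μ)) := by gcongr
    _ = N ^ (c - 1) * l ^ d / (2 * β * μ) := by
        rw [Real.rpow_sub_one hl.ne' d]; field_simp
    _ ≤ N ^ (c - 1) * (μ ^ (1 / α) / N) ^ d / (2 * β * μ) := by gcongr
    _ = 1 / (2 * β) * μ ^ (d / α - 1) * N ^ (c - 1 - d) := by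
        rw [Real.div_rpow (by positivity) hN.le, ← Real.rpow_mul hμ.le,
          Real.rpow_sub_one hμ.ne', Real.rpow_sub hN (c - 1) d,
          show 1 / α * d = d / α by ring]
        field_simp

lemma summable_two_mul_add_rpow (n : ℕ) {q : ℝ} (hq : q < -1) :
    Summable (fun k : ℕ => (2 * k + n : ℝ) ^ q) := by
  have hinj : Function.Injective (fun k : ℕ => 2 * k + n) := fun a b h => by
    simp only at h; omega
  simpa [Function.comp_def] using (Real.summable_nat_rpow.mpr hq).comp_injective hinj

/-- (case `α > 2β`, `μ > 1`) Bound for the series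
`∑_k (2k+n)^a (lam k μ)^b (lam k μ)'` by `C μ^((2/α)(n+m)(1/p−1/2) − 1)`. -/
theorem stmt10 (n m : ℕ) (hn : 1 ≤ n) (hm : 2 ≤ m) (α β : ℝ) (hα : 0 < α) (hβ : 0 < β)
    (hαβ : 2 * β < α) (p : ℝ) (hp1 : 1 ≤ p) (hp2 : p ≤ (2 * m + 2) / (m + 3))
    (lam : ℕ → ℝ → ℝ)
    (hlam : ∀ k : ℕ, ∀ μ : ℝ, 0 < μ → 0 < lam k μ ∧
      (2 * k + n : ℝ) ^ α * (lam k μ) ^ α + (lam k μ) ^ (2 * β) = μ) :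
    ∃ C : ℝ, 0 < C ∧ ∀ μ : ℝ, 1 < μ →
      Summable (fun k : ℕ =>
        (2 * k + n : ℝ) ^ (2 * n * (1 / p - 1 / 2) - 1) *
          (lam k μ) ^ (2 * (n + m : ℝ) * (1 / p - 1 / 2) - 1) *
          (1 / (α * (2 * k + n : ℝ) ^ α * (lam k μ) ^ (α - 1) +
                2 * β * (lam k μ) ^ (2 * β - 1)))) ∧
      (∑' k : ℕ,
        (2 * k + n : ℝ) ^ (2 * n * (1 / p - 1 / 2) - 1) *
          (lam k μ) ^ (2 * (n + m : ℝ) * (1 / p - 1 / 2) - 1) *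
          (1 / (α * (2 * k + n : ℝ) ^ α * (lam k μ) ^ (α - 1) +
                2 * β * (lam k μ) ^ (2 * β - 1))))
        ≤ C * μ ^ ((2 / α) * (n + m : ℝ) * (1 / p - 1 / 2) - 1) := by
  have hp : 0 < p := by linarith
  have hs : 0 < 1 / p - 1 / 2 := by
    have hm' : (2 : ℝ) ≤ m := by exact_mod_cast hm
    have : p < 2 := hp2.trans_lt (by rw [div_lt_iff₀ (by positivity)]; linarith)
    linarith [one_div_lt_one_div_of_lt hp this]
  generalize 1 / p - 1 / 2 = s at hs ⊢
  have hn' : (1 : ℝ) ≤ n := by exact_mod_cast hn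
  have hm' : (2 : ℝ) ≤ m := by exact_mod_cast hm
  have hsum := summable_two_mul_add_rpow n
    (q := 2 * n * s - 1 - 2 * (n + m : ℝ) * s)
    (by nlinarith [mul_pos (by linarith : (0 : ℝ) < m) hs])
  have hpos : ∀ k : ℕ, (0 : ℝ) < 2 * k + n := fun k => by positivity
  refine ⟨1 / (2 * β) * ∑' k : ℕ, (2 * k + n : ℝ) ^ (2 * n * s - 1 - 2 * (n + m : ℝ) * s),
    mul_pos (by positivity) (hsum.tsum_pos (fun k => by positivity) 0
      (Real.rpow_pos_of_pos (hpos 0) _)), fun μ hμ => ?_⟩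
  have hμ0 : 0 < μ := by linarith
  have hle := fun k : ℕ => spectral_term_le (c := 2 * n * s) (d := 2 * (n + m : ℝ) * s) hα hβ
    hαβ.le (hpos k) (hlam k μ hμ0).1 hμ0 (by positivity) (hlam k μ hμ0).2
  have hmaj := hsum.mul_left (1 / (2 * β) * μ ^ (2 * (n + m : ℝ) * s / α - 1))
  have hS := Summable.of_nonneg_of_le (fun k => by have := (hlam k μ hμ0).1; positivity) hle hmaj
  refine ⟨hS, (hS.tsum_le_tsum hle hmaj).trans_eq ?_⟩
  rw [tsum_mul_left, show 2 / α * (n + m : ℝ) * s - 1 = 2 * (n + m : ℝ) * s / α - 1 by ring]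
  ring
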